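/- arXiv:1809.06770 — 4 statements merged into one kernel-verified Lean document; each statement's English description precedes it below -/
import Mathlib

section
/- Cross-derivative identity (single-crossing term, l-revealing side): let V : ℝ → ℝ be twice continuously differentiable on an open set containing [0,1]. Define ΔV(μ,q) = q(1−μ)·V(0) + (1 − q(1−μ))·V(ν) − V(μ) with ν = μ/(1 − q(1−μ)). Then for all μ ∈ (0,1) and q ∈ (0,1), the mixed second partial derivative ∂²ΔV/∂μ∂q equals V(ν) − V(0) − ν·V'(ν) + V''(ν)·ν²(1−ν)/μ. -/
/-- Cross-derivative identity (single-crossing term, l-revealing side): for a `C²` value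
function `V`, the mixed second partial `∂²ΔV/∂μ∂q` of the buyer's surplus
`ΔV(μ,q) = q(1−μ)V(0) + (1−q(1−μ))V(ν) − V(μ)`, with `ν = μ/(1−q(1−μ))`, equals
`V(ν) − V(0) − ν·V'(ν) + V''(ν)·ν²(1−ν)/μ`. -/
theorem stmt7 (V : ℝ → ℝ) (U : Set ℝ) (hU : IsOpen U) (hIcc : Set.Icc (0:ℝ) 1 ⊆ U)
    (hV : ContDiffOn ℝ 2 V U)
    (ΔV : ℝ → ℝ → ℝ)
    (hΔV : ∀ μ q, ΔV μ q =
      q * (1 - μ) * V 0 + (1 - q * (1 - μ)) * V (μ / (1 - q * (1 - μ))) - V μ) :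
    ∀ μ ∈ Set.Ioo (0:ℝ) 1, ∀ q ∈ Set.Ioo (0:ℝ) 1,
      deriv (fun m => deriv (fun q' => ΔV m q') q) μ =
        V (μ / (1 - q * (1 - μ))) - V 0
          - (μ / (1 - q * (1 - μ))) * deriv V (μ / (1 - q * (1 - μ)))
          + deriv (deriv V) (μ / (1 - q * (1 - μ)))
            * ((μ / (1 - q * (1 - μ)))^2 * (1 - μ / (1 - q * (1 - μ)))) / μ := by
  have den_pos : ∀ m ∈ Set.Ioo (0:ℝ) 1, ∀ q ∈ Set.Ioo (0:ℝ) 1, 0 < 1 - q * (1 - m) := by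
    rintro m ⟨_, _⟩ q ⟨_, _⟩
    nlinarith
  have post_mem : ∀ m ∈ Set.Ioo (0:ℝ) 1, ∀ q ∈ Set.Ioo (0:ℝ) 1,
      m / (1 - q * (1 - m)) ∈ U := by
    intro m hm q hq
    have hd := den_pos m hm q hq
    refine hIcc ⟨div_nonneg hm.1.le hd.le, (div_le_one hd).2 ?_⟩
    nlinarith [mul_pos (sub_pos.2 hm.2) (sub_pos.2 hq.2)]
  have hasDeriv_V : ∀ x ∈ U, HasDerivAt V (deriv V x) x := fun x hx =>
    ((hV.differentiableOn (by norm_num)).differentiableAt (hU.mem_nhds hx)).hasDerivAt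
  have hasDeriv_V' : ∀ x ∈ U, HasDerivAt (deriv V) (deriv (deriv V) x) x := fun x hx =>
    (((hV.deriv_of_isOpen hU (m := 1) (by norm_num)).differentiableOn
      (by norm_num)).differentiableAt (hU.mem_nhds hx)).hasDerivAt
  have deriv_q : ∀ m ∈ Set.Ioo (0:ℝ) 1, ∀ q ∈ Set.Ioo (0:ℝ) 1,
      deriv (fun q' => ΔV m q') q = (1 - m) * (V 0 - V (m / (1 - q * (1 - m)))
        + m / (1 - q * (1 - m)) * deriv V (m / (1 - q * (1 - m)))) := by
    intro m hm q hq
    have hd := (den_pos m hm q hq).ne'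
    have hden : HasDerivAt (fun q' : ℝ => 1 - q' * (1 - m)) (-(1 * (1 - m))) q :=
      ((hasDerivAt_id' q).mul_const (1 - m)).const_sub 1
    have hpost := (hasDerivAt_const q m).fun_div hden hd
    have hcomp := (hasDeriv_V _ (post_mem m hm q hq)).comp q hpost
    have key := (((((hasDerivAt_id' q).mul_const (1 - m)).mul_const (V 0)).fun_add
      (hden.fun_mul hcomp)).sub_const (V m)).deriv
    simp only [hΔV]
    refine key.trans ?_
    simp only [Function.comp_apply]
    generalize V (m / (1 - q * (1 - m))) = a
    generalize deriv V (m / (1 - q * (1 - m))) = b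
    field_simp
    ring
  intro μ hμ q hq
  have hd := (den_pos μ hμ q hq).ne'
  have hμ0 := hμ.1.ne'
  have heq : (fun m => deriv (fun q' => ΔV m q') q) =ᶠ[nhds μ] fun m =>
      (1 - m) * (V 0 - V (m / (1 - q * (1 - m)))
        + m / (1 - q * (1 - m)) * deriv V (m / (1 - q * (1 - m)))) := by
    filter_upwards [isOpen_Ioo.mem_nhds hμ] with m hm using deriv_q m hm q hq
  rw [heq.deriv_eq]
  have hsub : HasDerivAt (fun m : ℝ => 1 - m) (-1) μ := (hasDerivAt_id' μ).const_sub 1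
  have hden := (hsub.const_mul q).const_sub 1
  have hpost := (hasDerivAt_id' μ).fun_div hden hd
  have hV₁ := (hasDeriv_V _ (post_mem μ hμ q hq)).comp μ hpost
  have hV₂ := (hasDeriv_V' _ (post_mem μ hμ q hq)).comp μ hpost
  refine (hsub.fun_mul ((hV₁.const_sub (V 0)).fun_add (hpost.fun_mul hV₂))).deriv.trans ?_
  simp only [Function.comp_apply]
  generalize V (μ / (1 - q * (1 - μ))) = a
  generalize deriv V (μ / (1 - q * (1 - μ))) = b
  generalize deriv (deriv V) (μ / (1 - q * (1 - μ))) = c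
  field_simp
  ring
end

section
/- Cross-derivative identity (single-crossing term, h-revealing side): let V : ℝ → ℝ be twice continuously differentiable on an open set containing [0,1]. Define ΔṼ(μ,p) = pμ·V(1) + (1 − pμ)·V(ν₂) − V(μ) with ν₂ = μ(1−p)/(1 − pμ). Then for all μ ∈ (0,1) and p ∈ (0,1), the mixed second partial derivative ∂²ΔṼ/∂μ∂p equals V(1) − V(ν₂) − (1−ν₂)·V'(ν₂) − V''(ν₂)·ν₂(1−ν₂)²/(1−μ). -/
/-- The non-conclusive posterior of the simple revealing experiment lies in `[0,1]`. -/
theorem revealing_posterior_mem_Icc {m p : ℝ} (hm : m ∈ Set.Ioo (0:ℝ) 1)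
    (hp : p ∈ Set.Ioo (0:ℝ) 1) :
    0 < 1 - p * m ∧ m * (1 - p) / (1 - p * m) ∈ Set.Icc (0:ℝ) 1 := by
  obtain ⟨hm0, hm1⟩ := hm
  obtain ⟨hp0, hp1⟩ := hp
  have hD : 0 < 1 - p * m := by nlinarith
  refine ⟨hD, div_nonneg (mul_nonneg hm0.le (by linarith)) hD.le, ?_⟩
  rw [div_le_one hD]
  linarith

theorem hasDerivAt_revealing_posterior_precision {m p : ℝ} (hD : 1 - p * m ≠ 0) :
    HasDerivAt (fun q => m * (1 - q) / (1 - q * m)) (-(m * (1 - m)) / (1 - p * m) ^ 2) p := by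
  have h := (((hasDerivAt_id' p).const_sub 1).const_mul m).fun_div
    (((hasDerivAt_id' p).mul_const m).const_sub 1) hD
  exact h.congr_deriv (by ring)

theorem hasDerivAt_revealing_posterior_prior {m p : ℝ} (hD : 1 - p * m ≠ 0) :
    HasDerivAt (fun x => x * (1 - p) / (1 - p * x)) ((1 - p) / (1 - p * m) ^ 2) m := by
  have h := ((hasDerivAt_id' m).mul_const (1 - p)).fun_div
    (((hasDerivAt_id' m).const_mul p).const_sub 1) hD
  exact h.congr_deriv (by ring)

/-- The derivative in the precision of the buyer's surplus. -/
theorem hasDerivAt_revealing_surplus_precision {V : ℝ → ℝ} {m p : ℝ} (hD : 1 - p * m ≠ 0)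
    (hV : DifferentiableAt ℝ V (m * (1 - p) / (1 - p * m))) :
    HasDerivAt
      (fun q => q * m * V 1 + (1 - q * m) * V (m * (1 - q) / (1 - q * m)) - V m)
      (m * V 1 - m * V (m * (1 - p) / (1 - p * m))
        - m * (1 - m) / (1 - p * m) * deriv V (m * (1 - p) / (1 - p * m))) p := by
  have hc := hV.hasDerivAt.comp p (hasDerivAt_revealing_posterior_precision hD)
  have h := ((((hasDerivAt_id' p).mul_const m).mul_const (V 1)).fun_add
    ((((hasDerivAt_id' p).mul_const m).const_sub 1).fun_mul hc)).sub_const (V m)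
  refine h.congr_deriv ?_
  simp only [Function.comp_apply]
  field_simp
  ring


/-- Cross-derivative identity (single-crossing term, h-revealing side): for a `C²` value
function `V`, the mixed second partial `∂²ΔṼ/∂μ∂p` of the buyer's surplus
`ΔṼ(μ,p) = pμV(1) + (1−pμ)V(ν₂) − V(μ)`, with `ν₂ = μ(1−p)/(1−pμ)`, equals
`V(1) − V(ν₂) − (1−ν₂)·V'(ν₂) − V''(ν₂)·ν₂(1−ν₂)²/(1−μ)`. -/
theorem stmt9 (V : ℝ → ℝ) (U : Set ℝ) (hU : IsOpen U) (hIcc : Set.Icc (0:ℝ) 1 ⊆ U)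
    (hV : ContDiffOn ℝ 2 V U)
    (ΔV : ℝ → ℝ → ℝ)
    (hΔV : ∀ μ p, ΔV μ p =
      p * μ * V 1 + (1 - p * μ) * V (μ * (1 - p) / (1 - p * μ)) - V μ) :
    ∀ μ ∈ Set.Ioo (0:ℝ) 1, ∀ p ∈ Set.Ioo (0:ℝ) 1,
      deriv (fun m => deriv (fun p' => ΔV m p') p) μ =
        V 1 - V (μ * (1 - p) / (1 - p * μ))
          - (1 - μ * (1 - p) / (1 - p * μ)) * deriv V (μ * (1 - p) / (1 - p * μ))
          - deriv (deriv V) (μ * (1 - p) / (1 - p * μ))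
            * ((μ * (1 - p) / (1 - p * μ)) * (1 - μ * (1 - p) / (1 - p * μ))^2) / (1 - μ) := by
  intro μ hμ p hp
  have hV1 : ∀ x ∈ U, DifferentiableAt ℝ V x := fun x hx =>
    (hV.contDiffAt (hU.mem_nhds hx)).differentiableAt (by norm_num)
  have hdV : ContDiffOn ℝ 1 (deriv V) U := hV.deriv_of_isOpen hU (by norm_num)
  have hV2 : ∀ x ∈ U, DifferentiableAt ℝ (deriv V) x := fun x hx =>
    (hdV.contDiffAt (hU.mem_nhds hx)).differentiableAt (by norm_num)
  have heq : (fun m => deriv (fun p' => ΔV m p') p) =ᶠ[nhds μ] fun m =>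
      m * V 1 - m * V (m * (1 - p) / (1 - p * m))
        - m * (1 - m) / (1 - p * m) * deriv V (m * (1 - p) / (1 - p * m)) := by
    filter_upwards [isOpen_Ioo.mem_nhds hμ] with m hm
    obtain ⟨hD, hν⟩ := revealing_posterior_mem_Icc hm hp
    simp only [hΔV]
    exact (hasDerivAt_revealing_surplus_precision hD.ne' (hV1 _ (hIcc hν))).deriv
  rw [heq.deriv_eq]
  obtain ⟨hDpos, hν⟩ := revealing_posterior_mem_Icc hμ hp
  have hD := hDpos.ne'
  have hD' : 1 - μ * p ≠ 0 := by rwa [mul_comm μ p]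
  have hμ1 : 1 - μ ≠ 0 := (sub_pos.mpr hμ.2).ne'
  have hνμ := hasDerivAt_revealing_posterior_prior hD
  have hc := (hV1 _ (hIcc hν)).hasDerivAt.comp μ hνμ
  have hc' := (hV2 _ (hIcc hν)).hasDerivAt.comp μ hνμ
  have hw := ((hasDerivAt_id' μ).fun_mul ((hasDerivAt_id' μ).const_sub 1)).fun_div
    (((hasDerivAt_id' μ).const_mul p).const_sub 1) hD
  have h := (((hasDerivAt_id' μ).mul_const (V 1)).fun_sub
    ((hasDerivAt_id' μ).fun_mul hc)).fun_sub (hw.fun_mul hc')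
  refine h.deriv.trans ?_
  simp only [Function.comp_apply]
  have hsub : 1 - μ * (1 - p) / (1 - p * μ) = (1 - μ) / (1 - p * μ) := by
    field_simp
    ring
  rw [hsub]
  generalize V (μ * (1 - p) / (1 - p * μ)) = a
  generalize deriv V (μ * (1 - p) / (1 - p * μ)) = b
  generalize deriv (deriv V) (μ * (1 - p) / (1 - p * μ)) = c
  field_simp
  ring
end

section
/- Existence of the threshold types: let f : [0,1] → ℝ be continuous with f(μ) > 0 for all μ ∈ (0,1), let F(μ) = ∫₀^μ f(ν)dν with F(1) = 1, let λ ∈ (0,1), and let μ⁰ ∈ (0,1) satisfy F(μ⁰) = 1 − λ. Then there exists μ⁻ ∈ (0, μ⁰) with f(μ⁻)·μ⁻ + (λ + F(μ⁻) − 1) = 0, and there exists μ⁺ ∈ (μ⁰, 1) with f(μ⁺)·(1−μ⁺) − (λ + F(μ⁺) − 1) = 0. -/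
open MeasureTheory intervalIntegral

/-- Existence of the threshold types `μ⁻ ∈ (0, μ⁰)` and `μ⁺ ∈ (μ⁰, 1)` delimiting the
region of buyer types to which the fully revealing experiment is sold. -/
theorem stmt15 (f : ℝ → ℝ) (hfc : ContinuousOn f (Set.Icc (0:ℝ) 1))
    (hfpos : ∀ μ ∈ Set.Ioo (0:ℝ) 1, 0 < f μ)
    (F : ℝ → ℝ) (hF : ∀ μ, F μ = ∫ ν in (0:ℝ)..μ, f ν) (hF1 : F 1 = 1)
    (l : ℝ) (hl : l ∈ Set.Ioo (0:ℝ) 1)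
    (μ0 : ℝ) (hμ0 : μ0 ∈ Set.Ioo (0:ℝ) 1) (hFμ0 : F μ0 = 1 - l) :
    (∃ μm ∈ Set.Ioo (0:ℝ) μ0, f μm * μm + (l + F μm - 1) = 0) ∧
    (∃ μp ∈ Set.Ioo μ0 1, f μp * (1 - μp) - (l + F μp - 1) = 0) := by
  obtain ⟨hl0, hl1⟩ := hl
  obtain ⟨h0, h1⟩ := hμ0
  have hF0 : F 0 = 0 := by rw [hF, integral_same]
  have hfμ0 := hfpos μ0 ⟨h0, h1⟩
  have hFc : ContinuousOn F (Set.Icc 0 1) := by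
    have hint : IntegrableOn f (Set.uIcc 0 1) := by
      rw [Set.uIcc_of_le zero_le_one]
      exact hfc.integrableOn_Icc
    have hprim := continuousOn_primitive_interval hint
    rw [Set.uIcc_of_le zero_le_one] at hprim
    exact hprim.congr fun μ _ => hF μ
  constructor
  · have hc : ContinuousOn (fun μ => f μ * μ + (l + F μ - 1)) (Set.Icc 0 μ0) :=
      ContinuousOn.mono (by fun_prop) (Set.Icc_subset_Icc_right h1.le)
    refine intermediate_value_Ioo h0.le hc ⟨?_, ?_⟩
    · simp only [hF0]
      linarith
    · simp only [hFμ0]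
      linarith [mul_pos hfμ0 h0]
  · have hc : ContinuousOn (fun μ => f μ * (1 - μ) - (l + F μ - 1)) (Set.Icc μ0 1) :=
      ContinuousOn.mono (by fun_prop) (Set.Icc_subset_Icc_left h0.le)
    refine intermediate_value_Ioo' h1.le hc ⟨?_, ?_⟩
    · simp only [hF1]
      linarith
    · simp only [hFμ0]
      linarith [mul_pos hfμ0 (sub_pos.2 h1)]
end

section
/- Monotone information provision in the quadratic-uniform example: the function ν(μ) = ((7/2)μ − 2μ² − 1)/(2μ − 1) satisfies ν(3/4) = 1 and ν(1) = 1/2, and is strictly antitone on (1/2, 1); consequently, in the optimal menu of Example 1 the posterior induced by the non-conclusive signal strictly decreases in the buyer's prior μ on (3/4, 1), i.e., buyers with more certain beliefs purchase strictly less informative experiments. -/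
/-- Monotone information provision in the quadratic-uniform example: the non-conclusive
posterior `ν(μ) = ((7/2)μ − 2μ² − 1)/(2μ − 1)` satisfies `ν(3/4) = 1` and `ν(1) = 1/2`,
and is strictly decreasing on `(1/2, 1)`; in particular it is strictly decreasing on
`(3/4, 1)`, so buyers with more certain beliefs purchase strictly less informative
experiments. -/
theorem stmt19 (ν : ℝ → ℝ) (hν : ∀ μ, ν μ = (7/2*μ - 2*μ^2 - 1) / (2*μ - 1)) :
    ν (3/4) = 1 ∧ ν 1 = 1/2 ∧ StrictAntiOn ν (Set.Ioo (1/2 : ℝ) 1) ∧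
    StrictAntiOn ν (Set.Ioo (3/4 : ℝ) 1) := by
  have hanti : StrictAntiOn ν (Set.Ioo (1/2 : ℝ) 1) := by
    intro a ha b hb hab
    have hta : 0 < 2*a - 1 := by linarith [ha.1]
    have htb : 0 < 2*b - 1 := by linarith [hb.1]
    rw [hν, hν, div_lt_div_iff₀ htb hta]
    nlinarith [mul_pos (mul_pos hta htb) (sub_pos.2 hab)]
  refine ⟨by rw [hν]; norm_num, by rw [hν]; norm_num, hanti, hanti.mono ?_⟩
  exact Set.Ioo_subset_Ioo_left (by norm_num)
end
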